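/- There is no homeomorphism h : ℙ² → ℙ² of the complex projective plane with h(C⁽¹⁾) = C⁽²⁾; i.e. the pairs (ℙ², C⁽¹⁾) and (ℙ², C⁽²⁾) are not homeomorphic, so C⁽¹⁾ and C⁽²⁾ form a Zariski pair. -/

import Mathlib

noncomputable section

open MvPolynomial

/-- the complex projective plane -/
abbrev P2 := Projectivization ℂ (Fin 3 → ℂ)

instance : TopologicalSpace P2 :=
  inferInstanceAs (TopologicalSpace (Quotient (projectivizationSetoid ℂ (Fin 3 → ℂ))))

/-- the zero locus in ℙ² of a homogeneous polynomial F: the set of points all of whose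
representative vectors are zeros of F -/
def VV (F : MvPolynomial (Fin 3) ℂ) : Set P2 :=
  {P | ∀ (v : Fin 3 → ℂ) (h : v ≠ 0), Projectivization.mk ℂ v h = P → eval v F = 0}

/-- the singular locus of the curve {F = 0}: points at which all three partial
derivatives of F vanish (at every representative vector) -/
def SingLoc (F : MvPolynomial (Fin 3) ℂ) : Set P2 :=
  {P | ∀ (v : Fin 3 → ℂ) (h : v ≠ 0), Projectivization.mk ℂ v h = P →
    ∀ i : Fin 3, eval v (pderiv i F) = 0}

/-- the conic F₁ = 8z²−20yz+36xz+17y²−18xy -/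
def F₁ : MvPolynomial (Fin 3) ℂ :=
  8 * X 2 ^ 2 - 20 * X 1 * X 2 + 36 * X 0 * X 2 + 17 * X 1 ^ 2 - 18 * X 0 * X 1

/-- the quartic Q₁ = 8x²z²−16xy²z+52x²yz−36x³z−37x²y²+18x³y−y⁴+20xy³ -/
def Q₁ : MvPolynomial (Fin 3) ℂ :=
  8 * X 0 ^ 2 * X 2 ^ 2 - 16 * X 0 * X 1 ^ 2 * X 2 + 52 * X 0 ^ 2 * X 1 * X 2
    - 36 * X 0 ^ 3 * X 2 - 37 * X 0 ^ 2 * X 1 ^ 2 + 18 * X 0 ^ 3 * X 1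
    - X 1 ^ 4 + 20 * X 0 * X 1 ^ 3

/-- the conic F₂ = 3x²+2xy+108z² -/
def F₂ : MvPolynomial (Fin 3) ℂ :=
  3 * X 0 ^ 2 + 2 * X 0 * X 1 + 108 * X 2 ^ 2

/-- the quartic Q₂ = 2xy³+3x²y²+108y²z²−x⁴ -/
def Q₂ : MvPolynomial (Fin 3) ℂ :=
  2 * X 0 * X 1 ^ 3 + 3 * X 0 ^ 2 * X 1 ^ 2 + 108 * X 1 ^ 2 * X 2 ^ 2 - X 0 ^ 4

open Set Filter Topology

theorem isPreconnected_ball_diff_finite (c : ℂ) {r : ℝ} (hr : 0 < r) {S : Set ℂ}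
    (hS : S.Finite) : IsPreconnected (Metric.ball c r \ S) := by
  let u := OpenPartialHomeomorph.univBall c r
  have hsrc : u.source = univ := OpenPartialHomeomorph.univBall_source c r
  have htgt : u.target = Metric.ball c r := OpenPartialHomeomorph.univBall_target c hr
  have hinj : Function.Injective u := by
    have := u.injOn
    rwa [hsrc, injOn_univ] at this
  have hfin : (u ⁻¹' S).Finite := hS.preimage hinj.injOn
  have hconn := (hfin.countable.isConnected_compl_of_one_lt_rank
    (Complex.rank_real_complex ▸ Nat.one_lt_ofNat)).isPreconnected
  have hcont : Continuous u := OpenPartialHomeomorph.continuous_univBall c r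
  have himg : u '' (u ⁻¹' S)ᶜ = Metric.ball c r \ S := by
    rw [← preimage_compl, image_preimage_eq_inter_range, ← image_univ, ← hsrc,
      u.image_source_eq_target, htgt, inter_comm]
    rfl
  exact himg ▸ hconn.image u hcont.continuousOn

theorem isPreconnected_compl_finite {S : Set ℂ} (hS : S.Finite) : IsPreconnected Sᶜ :=
  (hS.countable.isConnected_compl_of_one_lt_rank
    (Complex.rank_real_complex ▸ Nat.one_lt_ofNat)).isPreconnected

theorem dense_compl_finite {S : Set ℂ} (hS : S.Finite) : Dense Sᶜ :=
  hS.countable.dense_compl ℝ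

/-- A surjective closed self-map of the plane that is injective away from a finite set is
injective. -/
theorem injective_of_finite_exceptional {φ : ℂ → ℂ} (hc : Continuous φ) (hcl : IsClosedMap φ)
    (hsurj : Function.Surjective φ) {T : Set ℂ} (hT : T.Finite)
    (hinj : ∀ x ∉ T, ∀ y, φ x = φ y → x = y) : Function.Injective φ := by
  intro a a' haa
  by_contra hne
  obtain ⟨ε, hε, hεT⟩ : ∃ ε > 0, Metric.closedBall a ε ∩ (insert a' T \ {a}) = ∅ := by
    have hfin : (insert a' T \ {a}).Finite := (hT.insert a').subset sdiff_subset
    have : (insert a' T \ {a})ᶜ ∈ 𝓝 a := hfin.isClosed.isOpen_compl.mem_nhds (by simp)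
    obtain ⟨ε, hε, h⟩ := Metric.nhds_basis_closedBall.mem_iff.1 this
    exact ⟨ε, hε, (disjoint_left.2 fun x hx => h hx).inter_eq⟩
  have hfar : ∀ x ∈ insert a' T, x ≠ a → ε < dist x a := by
    intro x hx hxa
    by_contra! hle
    exact (hεT ▸ (⟨hle, hx, hxa⟩ : x ∈ Metric.closedBall a ε ∩ (insert a' T \ {a})) :
      x ∈ (∅ : Set ℂ))
  have hsph : φ a ∉ φ '' Metric.sphere a ε := by
    rintro ⟨x, hx, hxa⟩
    have hxne : x ≠ a := by
      rintro rfl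
      simp at hx
      exact hε.ne hx
    by_cases hxT : x ∈ T
    · exact (hfar x (mem_insert_of_mem _ hxT) hxne).ne' hx
    · exact hxne (hinj x hxT a hxa)
  obtain ⟨r, hr, hrS⟩ := Metric.isOpen_iff.1
    ((isCompact_sphere a ε).image hc).isClosed.isOpen_compl (φ a) hsph
  have hconn := isPreconnected_ball_diff_finite (φ a) hr (hT.image φ)
  rw [isPreconnected_closed_iff] at hconn
  have hoff : ∀ x ∉ T, φ x ∉ φ '' T := by
    rintro x hx ⟨t, ht, htx⟩
    exact hx (hinj x hx t htx.symm ▸ ht)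
  have hnear : ∀ O : Set ℂ, IsOpen O → ∀ q ∈ O, φ q = φ a →
      ∃ x ∈ O, φ x ∈ Metric.ball (φ a) r \ φ '' T := by
    intro O hO q hq hqa
    have hopen : IsOpen (O ∩ φ ⁻¹' Metric.ball (φ a) r) := hO.inter (Metric.isOpen_ball.preimage hc)
    obtain ⟨x, ⟨hxO, hxb⟩, hxT⟩ := (dense_compl_finite hT).inter_open_nonempty _ hopen
      ⟨q, hq, by simp [hqa, hr]⟩
    exact ⟨x, hxO, hxb, hoff x hxT⟩
  obtain ⟨y, hy, ⟨x₁, hx₁, hxy₁⟩, ⟨x₂, hx₂, hxy₂⟩⟩ := hconn (φ '' Metric.closedBall a ε)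
    (φ '' (Metric.ball a ε)ᶜ) (hcl _ Metric.isClosed_closedBall)
    (hcl _ Metric.isOpen_ball.isClosed_compl)
    (by
      intro y _
      obtain ⟨x, rfl⟩ := hsurj y
      by_cases hx : x ∈ Metric.ball a ε
      · exact Or.inl ⟨x, Metric.ball_subset_closedBall hx, rfl⟩
      · exact Or.inr ⟨x, hx, rfl⟩)
    (by
      obtain ⟨x, hx, hx'⟩ := hnear _ Metric.isOpen_ball a (Metric.mem_ball_self hε) rfl
      exact ⟨φ x, hx', x, Metric.ball_subset_closedBall hx, rfl⟩)
    (by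
      obtain ⟨x, hx, hx'⟩ := hnear (Metric.closedBall a ε)ᶜ
        Metric.isClosed_closedBall.isOpen_compl a'
        (by simpa using hfar a' (mem_insert _ _) (Ne.symm hne)) haa.symm
      refine ⟨φ x, hx', x, fun h => hx (Metric.ball_subset_closedBall h), rfl⟩)
  have hx₁T : x₁ ∉ T := fun h => hy.2 ⟨x₁, h, hxy₁⟩
  have h12 : x₁ = x₂ := hinj x₁ hx₁T x₂ (hxy₁.trans hxy₂.symm)
  have hsx : x₁ ∈ Metric.sphere a ε := by
    rw [← h12] at hx₂
    simp only [Metric.mem_closedBall, mem_compl_iff, Metric.mem_ball, not_lt] at hx₁ hx₂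
    exact le_antisymm hx₁ hx₂
  exact hrS hy.1 ⟨x₁, hsx, hxy₁⟩

/-- A continuous map from the plane that is injective off a finite set and extends continuously
to the sphere by sending the point at infinity to a point `P` outside the image. -/
structure IsPuncturedParam {Y : Type*} [TopologicalSpace Y] (f : ℂ → Y) (P : Y) : Prop where
  continuous : Continuous f
  tendsto : Tendsto f (cocompact ℂ) (𝓝 P)
  notMem_range : P ∉ range f
  exists_finite : ∃ T : Set ℂ, T.Finite ∧ ∀ x ∉ T, ∀ y, f x = f y → x = y

namespace IsPuncturedParam

variable {Y Z : Type*} [TopologicalSpace Y] [TopologicalSpace Z] {f g k n k' n' : ℂ → Y} {P P' : Y}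

theorem homeomorph_comp (hf : IsPuncturedParam f P) (e : Y ≃ₜ Z) :
    IsPuncturedParam (e ∘ f) (e P) where
  continuous := e.continuous.comp hf.continuous
  tendsto := (e.continuous.tendsto P).comp hf.tendsto
  notMem_range := by
    rintro ⟨x, hx⟩
    exact hf.notMem_range ⟨x, e.injective hx⟩
  exists_finite := by
    obtain ⟨T, hT, h⟩ := hf.exists_finite
    exact ⟨T, hT, fun x hx y hxy => h x hx y (e.injective hxy)⟩

theorem finite_preimage (hf : IsPuncturedParam f P) {S : Set Y} (hS : S.Finite) :
    (f ⁻¹' S).Finite := by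
  obtain ⟨T, hT, h⟩ := hf.exists_finite
  refine Finite.preimage' hS fun y _ => ?_
  by_cases hy : f ⁻¹' {y} ⊆ T
  · exact hT.subset hy
  · obtain ⟨x, hx, hxT⟩ := not_subset.1 hy
    refine (finite_singleton x).subset fun z hz => ?_
    exact (h x hxT z (hx.trans hz.symm)).symm

theorem isClosed_insert_image [T2Space Y] (hf : IsPuncturedParam f P) {A : Set ℂ}
    (hA : IsClosed A) : IsClosed (insert P (f '' A)) := by
  have h : Tendsto (f ∘ ((↑) : A → ℂ)) (cocompact A) (𝓝 P) :=
    hf.tendsto.comp hA.isClosedEmbedding_subtypeVal.tendsto_cocompact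
  have := (h.isCompact_insert_range_of_cocompact
    (hf.continuous.comp continuous_subtype_val)).isClosed
  rwa [range_comp, Subtype.range_coe] at this

theorem isClosed_insert_range [T2Space Y] (hf : IsPuncturedParam f P) :
    IsClosed (insert P (range f)) := by
  simpa using hf.isClosed_insert_image isClosed_univ

theorem isPreconnected_insert_diff (hf : IsPuncturedParam f P) {R : Y} (hR : R ≠ P) :
    IsPreconnected (insert P (range f) \ {R}) := by
  have hfin := hf.finite_preimage (finite_singleton R)
  have h := (isPreconnected_compl_finite hfin).image f hf.continuous.continuousOn
  refine h.subset_closure ?_ ?_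
  · rintro _ ⟨x, hx, rfl⟩
    exact ⟨Or.inr ⟨x, rfl⟩, hx⟩
  · rintro y ⟨rfl | ⟨x, rfl⟩, hy⟩
    · refine mem_closure_of_tendsto hf.tendsto ?_
      filter_upwards [hfin.isCompact.compl_mem_cocompact] with x hx using ⟨x, hx, rfl⟩
    · exact subset_closure ⟨x, hy, rfl⟩

theorem exists_continuous_factor [T2Space Y] (hf : IsPuncturedParam f P)
    (hinj : Function.Injective f) (hg : Continuous g) (hfg : range g ⊆ range f) :
    ∃ φ : ℂ → ℂ, Continuous φ ∧ ∀ x, f (φ x) = g x := by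
  choose φ hφ using fun x => hfg (mem_range_self x)
  refine ⟨φ, continuous_iff_isClosed.2 fun A hA => ?_, hφ⟩
  have : φ ⁻¹' A = g ⁻¹' insert P (f '' A) := by
    ext x
    simp only [mem_preimage, mem_insert_iff, mem_image]
    constructor
    · exact fun h => Or.inr ⟨φ x, h, hφ x⟩
    · rintro (h | ⟨z, hz, hzx⟩)
      · exact absurd ⟨φ x, (hφ x).trans h⟩ hf.notMem_range
      · rwa [hinj ((hφ x).trans hzx.symm)]
  rw [this]
  exact (hf.isClosed_insert_image hA).preimage hg

theorem injective_of_comp_eq [T2Space Y] (hf : IsPuncturedParam f P) (hg : IsPuncturedParam g P)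
    (hfg : range f = range g) {φ : ℂ → ℂ} (hφ : Continuous φ) (h : ∀ x, f (φ x) = g x) :
    Function.Injective φ := by
  have hcl : IsClosedMap φ := by
    refine (isProperMap_iff_tendsto_cocompact.2 ⟨hφ, ?_⟩).isClosedMap
    refine (hasBasis_cocompact.tendsto_right_iff).2 fun B hB => ?_
    have hB' : (f '' B)ᶜ ∈ 𝓝 P := (hB.image hf.continuous).isClosed.isOpen_compl.mem_nhds
      fun hP => hf.notMem_range (image_subset_range f B hP)
    filter_upwards [hg.tendsto hB'] with x hx hxB
    exact hx ⟨φ x, hxB, h x⟩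
  obtain ⟨T, hT, hTg⟩ := hg.exists_finite
  refine injective_of_finite_exceptional hφ hcl ?_ hT fun x hx y hxy => hTg x hx y ?_
  · obtain ⟨S, hS, hSf⟩ := hf.exists_finite
    have hsub : Sᶜ ⊆ range φ := by
      intro s hs
      obtain ⟨x, hx⟩ := hfg ▸ mem_range_self (f := f) s
      exact ⟨x, (hSf s hs (φ x) (hx ▸ (h x).symm)).symm⟩
    rw [← range_eq_univ]
    have := (dense_compl_finite hS).mono hsub
    rw [← hcl.isClosed_range.closure_eq, this.closure_eq]
  · rw [← h, ← h, hxy]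

/-- The common point is the only cut point of a union of two parametrized pieces. -/
theorem eq_of_insert_union_eq [T2Space Y] (hk : IsPuncturedParam k P) (hn : IsPuncturedParam n P)
    (hk' : IsPuncturedParam k' P') (hn' : IsPuncturedParam n' P')
    (hd' : Disjoint (range k') (range n'))
    (h : insert P (range k ∪ range n) = insert P' (range k' ∪ range n')) : P = P' := by
  by_contra hne
  have hconn : IsPreconnected (insert P (range k ∪ range n) \ {P'}) := by
    have hP (A : Set Y) : P ∈ insert P A \ {P'} := ⟨mem_insert _ _, hne⟩
    have := (hk.isPreconnected_insert_diff (Ne.symm hne)).union P (hP _) (hP _)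
      (hn.isPreconnected_insert_diff (Ne.symm hne))
    rwa [← union_sdiff_distrib, ← insert_union_distrib] at this
  rw [h, isPreconnected_closed_iff] at hconn
  obtain ⟨y, ⟨-, hy⟩, hy₁, hy₂⟩ := hconn _ _ hk'.isClosed_insert_range hn'.isClosed_insert_range
    (by rw [← insert_union_distrib]; exact sdiff_subset)
    ⟨k' 0, ⟨Or.inr (Or.inl ⟨0, rfl⟩), fun h => hk'.notMem_range ⟨0, h⟩⟩, Or.inr ⟨0, rfl⟩⟩
    ⟨n' 0, ⟨Or.inr (Or.inr ⟨0, rfl⟩), fun h => hn'.notMem_range ⟨0, h⟩⟩, Or.inr ⟨0, rfl⟩⟩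
  exact disjoint_left.1 hd' (hy₁.resolve_left hy) (hy₂.resolve_left hy)

theorem range_subset_or [T2Space Y] (hk : IsPuncturedParam k P) (hn : IsPuncturedParam n P)
    (hd : Disjoint (range k) (range n)) (hf : IsPuncturedParam f P)
    (h : range f ⊆ range k ∪ range n) : range f ⊆ range k ∨ range f ⊆ range n := by
  have hconn := isPreconnected_range hf.continuous
  have hP : ∀ y ∈ range f, y ≠ P := fun y hy hyP => hf.notMem_range (hyP ▸ hy)
  by_contra! hcon
  obtain ⟨h₁, h₂⟩ := hcon
  obtain ⟨y₁, hy₁, hy₁k⟩ := not_subset.1 h₁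
  obtain ⟨y₂, hy₂, hy₂n⟩ := not_subset.1 h₂
  obtain ⟨y, hy, hyk, hyn⟩ := isPreconnected_closed_iff.1 hconn _ _ hk.isClosed_insert_range
    hn.isClosed_insert_range
    (h.trans (union_subset_union (subset_insert _ _) (subset_insert _ _)))
    ⟨y₂, hy₂, Or.inr ((h hy₂).resolve_right hy₂n)⟩ ⟨y₁, hy₁, Or.inr ((h hy₁).resolve_left hy₁k)⟩
  exact disjoint_left.1 hd (hyk.resolve_left (hP y hy)) (hyn.resolve_left (hP y hy))

theorem range_eq_or [T2Space Y] (hk : IsPuncturedParam k P) (hn : IsPuncturedParam n P)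
    (hd : Disjoint (range k) (range n)) (hk' : IsPuncturedParam k' P)
    (hn' : IsPuncturedParam n' P)
    (h : insert P (range k ∪ range n) = insert P (range k' ∪ range n')) :
    range n' = range k ∨ (range n' = range n ∧ range k' = range k) := by
  have hunion : range k ∪ range n = range k' ∪ range n' := by
    have h₁ : P ∉ range k ∪ range n := by
      rintro (h | h)
      exacts [hk.notMem_range h, hn.notMem_range h]
    have h₂ : P ∉ range k' ∪ range n' := by
      rintro (h | h)
      exacts [hk'.notMem_range h, hn'.notMem_range h]
    rw [← insert_sdiff_self_of_notMem h₁, h, insert_sdiff_self_of_notMem h₂]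
  have hnk : ¬ (range n ⊆ range k) := fun hs =>
    disjoint_left.1 hd (hs ⟨0, rfl⟩) ⟨0, rfl⟩
  have hkn : ¬ (range k ⊆ range n) := fun hs =>
    disjoint_left.1 hd ⟨0, rfl⟩ (hs ⟨0, rfl⟩)
  have hcase (A B C D : Set Y) (hAB : Disjoint A B) (hu : A ∪ B = C ∪ D) (hC : C ⊆ A)
      (hD : D ⊆ B) : C = A ∧ D = B := by
    refine ⟨hC.antisymm fun x hx => ?_, hD.antisymm fun x hx => ?_⟩
    · have : x ∈ C ∪ D := hu ▸ Or.inl hx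
      exact this.resolve_right fun h => disjoint_left.1 hAB hx (hD h)
    · have : x ∈ C ∪ D := hu ▸ Or.inr hx
      exact this.resolve_left fun h => disjoint_left.1 hAB (hC h) hx
  rcases range_subset_or hk hn hd hk' (hunion ▸ subset_union_left) with h₁ | h₁ <;>
  rcases range_subset_or hk hn hd hn' (hunion ▸ subset_union_right) with h₂ | h₂
  · exact absurd (hunion ▸ (union_subset h₁ h₂) : range k ∪ range n ⊆ range k)
      fun hs => hnk (subset_union_right.trans hs)
  · exact Or.inr (hcase _ _ _ _ hd hunion h₁ h₂).symm
  · exact Or.inl (hcase _ _ _ _ hd.symm (by rw [union_comm, hunion]) h₁ h₂).2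
  · exact absurd (hunion ▸ (union_subset h₁ h₂) : range k ∪ range n ⊆ range n)
      fun hs => hkn (subset_union_left.trans hs)

end IsPuncturedParam
open Set Filter Topology

/-- The point of the projective plane with homogeneous coordinates `v`, with a junk value at
`v = 0`. -/
def pt (v : Fin 3 → ℂ) : P2 :=
  if h : v ≠ 0 then Projectivization.mk ℂ v h else
    Projectivization.mk ℂ ![1, 0, 0] fun h => one_ne_zero (congrFun h 0 : (1 : ℂ) = 0)

theorem pt_of_ne_zero {v : Fin 3 → ℂ} (h : v ≠ 0) : pt v = Projectivization.mk ℂ v h := dif_pos h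

theorem pt_eq_pt_iff {v w : Fin 3 → ℂ} (hv : v ≠ 0) (hw : w ≠ 0) :
    pt v = pt w ↔ ∃ a : ℂ, a • w = v := by
  rw [pt_of_ne_zero hv, pt_of_ne_zero hw, Projectivization.mk_eq_mk_iff']

theorem pt_smul {v : Fin 3 → ℂ} (hv : v ≠ 0) {c : ℂ} (hc : c ≠ 0) : pt (c • v) = pt v :=
  (pt_eq_pt_iff (smul_ne_zero hc hv) hv).2 ⟨c, rfl⟩

theorem pt_neg {v : Fin 3 → ℂ} (hv : v ≠ 0) : pt (-v) = pt v := by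
  rw [← pt_smul hv (neg_ne_zero.2 one_ne_zero), neg_one_smul]

theorem exists_pt_eq (P : P2) : ∃ v, v ≠ 0 ∧ pt v = P :=
  ⟨P.rep, P.rep_nonzero, by rw [pt_of_ne_zero P.rep_nonzero, P.mk_rep]⟩

theorem isQuotientMap_restrict_pt :
    IsQuotientMap fun v : {v : Fin 3 → ℂ // v ≠ 0} => pt v := by
  have : (fun v : {v : Fin 3 → ℂ // v ≠ 0} => pt v) =
      Quotient.mk (projectivizationSetoid ℂ (Fin 3 → ℂ)) :=
    funext fun v => pt_of_ne_zero v.2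
  rw [this]
  exact isQuotientMap_quotient_mk'

theorem continuousOn_pt : ContinuousOn pt {0}ᶜ :=
  continuousOn_iff_continuous_domRestrict.2 isQuotientMap_restrict_pt.continuous

theorem continuousAt_pt {v : Fin 3 → ℂ} (hv : v ≠ 0) : ContinuousAt pt v :=
  continuousOn_pt.continuousAt (isOpen_compl_singleton.mem_nhds hv)

theorem Continuous.pt_comp {A : Type*} [TopologicalSpace A] {f : A → Fin 3 → ℂ}
    (hf : Continuous f) (h0 : ∀ a, f a ≠ 0) : Continuous fun a => pt (f a) :=
  continuous_iff_continuousAt.2 fun a => (continuousAt_pt (h0 a)).comp hf.continuousAt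

theorem isOpen_of_isOpen_pt_preimage {s : Set P2} (h : ∀ v ≠ 0, pt v ∈ s → ∀ᶠ w in 𝓝 v, pt w ∈ s) :
    IsOpen s := by
  rw [← isQuotientMap_restrict_pt.isOpen_preimage, isOpen_iff_mem_nhds]
  intro v hv
  exact continuous_subtype_val.continuousAt.eventually (h v v.2 hv)

theorem isOpenMap_restrict_pt : IsOpenMap fun v : {v : Fin 3 → ℂ // v ≠ 0} => pt v := by
  intro O hO
  refine isOpen_of_isOpen_pt_preimage ?_
  rintro v hv ⟨w, hw, hwv⟩
  obtain ⟨a, ha⟩ := (pt_eq_pt_iff w.2 hv).1 hwv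
  have ha0 : a ≠ 0 := by
    rintro rfl
    exact w.2 (by simpa using ha.symm)
  have hO' : IsOpen (Subtype.val '' O) := isOpen_compl_singleton.isOpenMap_subtype_val _ hO
  have hcont : Continuous fun u : Fin 3 → ℂ => a • u := continuous_const_smul a
  have hmem : a • v ∈ Subtype.val '' O := ha ▸ ⟨w, hw, rfl⟩
  filter_upwards [hcont.continuousAt.eventually (hO'.mem_nhds hmem),
    isOpen_compl_singleton.mem_nhds hv] with u hu hu0
  obtain ⟨z, hz, hzu⟩ := hu
  exact ⟨z, hz, by simp only [hzu, pt_smul hu0 ha0]⟩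

instance : T2Space P2 := by
  have hq : IsOpenQuotientMap fun v : {v : Fin 3 → ℂ // v ≠ 0} => pt v :=
    ⟨isQuotientMap_restrict_pt.surjective, isQuotientMap_restrict_pt.continuous,
      isOpenMap_restrict_pt⟩
  rw [t2Space_iff_of_isOpenQuotientMap hq]
  have : {q : {v : Fin 3 → ℂ // v ≠ 0} × {v : Fin 3 → ℂ // v ≠ 0} | pt q.1 = pt q.2} =
      ⋂ i, ⋂ j, {q | q.1.1 i * q.2.1 j = q.1.1 j * q.2.1 i} := by
    ext ⟨⟨v, hv⟩, ⟨w, hw⟩⟩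
    simp only [mem_ofPred_eq, mem_iInter]
    rw [pt_eq_pt_iff hv hw]
    constructor
    · rintro ⟨a, rfl⟩ i j
      simp only [Pi.smul_apply, smul_eq_mul]
      ring
    · intro h
      obtain ⟨j, hj⟩ := Function.ne_iff.1 hw
      refine ⟨v j / w j, funext fun i => ?_⟩
      have hj' : w j ≠ 0 := hj
      simp only [Pi.smul_apply, smul_eq_mul]
      rw [div_mul_eq_mul_div, div_eq_iff hj', h]
  rw [this]
  have h₁ (i : Fin 3) : Continuous fun q : {v : Fin 3 → ℂ // v ≠ 0} × {v : Fin 3 → ℂ // v ≠ 0} =>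
      q.1.1 i := (continuous_apply i).comp (continuous_subtype_val.comp continuous_fst)
  have h₂ (i : Fin 3) : Continuous fun q : {v : Fin 3 → ℂ // v ≠ 0} × {v : Fin 3 → ℂ // v ≠ 0} =>
      q.2.1 i := (continuous_apply i).comp (continuous_subtype_val.comp continuous_snd)
  exact isClosed_iInter fun i => isClosed_iInter fun j =>
    isClosed_eq ((h₁ i).mul (h₂ j)) ((h₁ j).mul (h₂ i))

theorem pt_mem_VV {F : MvPolynomial (Fin 3) ℂ} {d : ℕ}
    (hF : ∀ (c : ℂ) v, eval (c • v) F = c ^ d * eval v F) {v : Fin 3 → ℂ} (hv : v ≠ 0) :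
    pt v ∈ VV F ↔ eval v F = 0 := by
  constructor
  · exact fun h => h v hv (pt_of_ne_zero hv).symm
  · intro h w hw hwv
    rw [← pt_of_ne_zero hw, pt_eq_pt_iff hw hv] at hwv
    obtain ⟨a, rfl⟩ := hwv
    rw [hF, h, mul_zero]

section DoubleCover

variable {q : (Fin 3 → ℂ) → ℂ}

theorem ne_zero_of_quadratic (hq : ∀ (c : ℂ) v, q (c • v) = c ^ 2 * q v) {v : Fin 3 → ℂ}
    (hv : q v ≠ 0) : v ≠ 0 := by
  rintro rfl
  apply hv
  simpa using hq 0 0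

theorem eq_or_eq_neg_of_pt_eq (hq : ∀ (c : ℂ) v, q (c • v) = c ^ 2 * q v) {v w : Fin 3 → ℂ}
    (hv : q v = 1) (hw : q w = 1) (h : pt v = pt w) : v = w ∨ v = -w := by
  obtain ⟨a, rfl⟩ := (pt_eq_pt_iff (ne_zero_of_quadratic hq (hv ▸ one_ne_zero))
    (ne_zero_of_quadratic hq (hw ▸ one_ne_zero))).1 h
  rw [hq, hw, mul_one] at hv
  rcases (sq_eq_sq_iff_eq_or_eq_neg.1 (hv.trans (one_pow 2).symm)) with rfl | rfl
  · simp
  · simp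

/-- The action of the signs on the affine quadric `q = 1`. -/
@[reducible] def signAction (hq : ∀ (c : ℂ) v, q (c • v) = c ^ 2 * q v) :
    MulAction ℤˣ {v // q v = 1} where
  smul ε v := ⟨((ε : ℤ) : ℂ) • v.1, by
    rw [hq, v.2]
    rcases Int.units_eq_one_or ε with rfl | rfl <;> simp⟩
  one_smul v := Subtype.ext (by
    change (((1 : ℤˣ) : ℤ) : ℂ) • v.1 = v.1
    simp)
  mul_smul ε δ v := Subtype.ext (by
    change (((ε * δ : ℤˣ) : ℤ) : ℂ) • v.1 = ((ε : ℤ) : ℂ) • (((δ : ℤ) : ℂ) • v.1)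
    rw [smul_smul]
    push_cast
    rfl)

/-- The projection from the affine quadric `q = 1` to the complement of the conic `q = 0`. -/
def quadricProj (q : (Fin 3 → ℂ) → ℂ) (v : {v // q v = 1}) :
    (pt '' {v | q v ≠ 0} : Set P2) :=
  ⟨pt v, v, by simp [v.2], rfl⟩

theorem isOpen_pt_image (hq : ∀ (c : ℂ) v, q (c • v) = c ^ 2 * q v) (hc : Continuous q) :
    IsOpen (pt '' {v | q v ≠ 0}) := by
  refine isOpen_of_isOpen_pt_preimage ?_
  rintro v hv ⟨w, hw, hwv⟩
  obtain ⟨a, rfl⟩ := (pt_eq_pt_iff (ne_zero_of_quadratic hq hw) hv).1 hwv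
  have hv' : q v ≠ 0 := fun h => hw (by rw [hq, h, mul_zero])
  filter_upwards [hc.continuousAt.eventually_ne hv'] with u hu using ⟨u, hu, rfl⟩

theorem isQuotientMap_quadricProj (hq : ∀ (c : ℂ) v, q (c • v) = c ^ 2 * q v)
    (hc : Continuous q) : IsQuotientMap (quadricProj q) := by
  have hcont : Continuous (quadricProj q) :=
    (continuous_subtype_val.pt_comp fun v => ne_zero_of_quadratic hq
      (v.2.symm ▸ one_ne_zero)).subtype_mk _
  have hmk (w : Fin 3 → ℂ) (r : ℂ) (hr : r ≠ 0) (hrw : r ^ 2 = q w) : q (r⁻¹ • w) = 1 := by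
    rw [hq, ← hrw, inv_pow, inv_mul_cancel₀ (pow_ne_zero 2 hr)]
  refine (isQuotientMap_iff _).2 ⟨.of_isOpen_preimage_iff_isOpen fun s =>
    ⟨fun h => ?_, fun h => h.preimage hcont⟩, ?_⟩
  · rw [(isOpen_pt_image hq hc).isOpenEmbedding_subtypeVal.isOpen_iff_image_isOpen]
    refine isOpen_of_isOpen_pt_preimage ?_
    rintro v hv ⟨⟨_, w, hw, rfl⟩, hs, hwv⟩
    obtain ⟨a, rfl⟩ := (pt_eq_pt_iff (ne_zero_of_quadratic hq hw) hv).1 hwv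
    have hqv : q v ≠ 0 := fun h => hw (by rw [hq, h, mul_zero])
    obtain ⟨r, hr⟩ := IsAlgClosed.exists_pow_nat_eq (q v) zero_lt_two
    have hr0 : r ≠ 0 := by
      rintro rfl
      exact hqv (by simp [← hr])
    let ρ : (Fin 3 → ℂ) → ℂ := fun u => r * (q u / q v) ^ ((2 : ℕ) : ℂ)⁻¹
    have hρ2 (u) : ρ u ^ 2 = q u := by
      rw [mul_pow, Complex.cpow_nat_inv_pow _ two_ne_zero, hr, mul_div_cancel₀ _ hqv]
    have hρv : ρ v = r := by simp [ρ, hqv]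
    have hρc : ContinuousAt ρ v :=
      ContinuousAt.mul continuousAt_const
        (ContinuousAt.cpow (hc.continuousAt.div_const _) continuousAt_const (by simp [hqv]))
    have hσ : ContinuousAt (fun u => (ρ u)⁻¹ • u) v :=
      (hρc.inv₀ (by rwa [hρv])).smul continuousAt_id
    obtain ⟨O, hO, hOs⟩ := isOpen_induced_iff.1 h
    have key (u : Fin 3 → ℂ) (hu : q u ≠ 0) :
        (ρ u)⁻¹ • u ∈ O ↔ (⟨pt u, u, hu, rfl⟩ : (pt '' {v | q v ≠ 0} : Set P2)) ∈ s := by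
      have hρ0 : ρ u ≠ 0 := fun h => hu (by rw [← hρ2, h]; simp)
      have h1 : q ((ρ u)⁻¹ • u) = 1 := hmk u _ hρ0 (hρ2 u)
      have h2 : quadricProj q ⟨(ρ u)⁻¹ • u, h1⟩ = ⟨pt u, u, hu, rfl⟩ :=
        Subtype.ext (pt_smul (ne_zero_of_quadratic hq hu) (inv_ne_zero hρ0))
      rw [← h2]
      exact Set.ext_iff.1 hOs ⟨(ρ u)⁻¹ • u, h1⟩
    have hvO : (ρ v)⁻¹ • v ∈ O := by
      rw [key v hqv]
      have hs' : (⟨pt v, v, hqv, rfl⟩ : (pt '' {v | q v ≠ 0} : Set P2)) =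
          ⟨pt (a • v), a • v, hw, rfl⟩ := Subtype.ext hwv.symm
      rwa [hs']
    filter_upwards [hσ.eventually (hO.mem_nhds hvO), hc.continuousAt.eventually_ne hqv]
      with u hu hqu using ⟨_, (key u hqu).1 hu, rfl⟩
  · rintro ⟨_, w, hw, rfl⟩
    obtain ⟨r, hr⟩ := IsAlgClosed.exists_pow_nat_eq (q w) zero_lt_two
    have hr0 : r ≠ 0 := by
      rintro rfl
      exact hw (by simp [← hr])
    exact ⟨⟨r⁻¹ • w, hmk w r hr0 hr⟩, Subtype.ext
      (pt_smul (ne_zero_of_quadratic hq hw) (inv_ne_zero hr0))⟩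

theorem isCoveringMap_quadricProj (hq : ∀ (c : ℂ) v, q (c • v) = c ^ 2 * q v)
    (hc : Continuous q) : IsCoveringMap (quadricProj q) := by
  let := signAction hq
  have hsmul (ε : ℤˣ) (v : {v // q v = 1}) : (ε • v).1 = ((ε : ℤ) : ℂ) • v.1 := rfl
  suffices h : IsQuotientCoveringMap (quadricProj q) ℤˣ from h.isCoveringMap
  refine
    { toIsQuotientMap := isQuotientMap_quadricProj hq hc
      continuous_const_smul := fun ε =>
        (continuous_subtype_val.const_smul (((ε : ℤ) : ℂ))).subtype_mk _
      apply_eq_iff_mem_orbit := ?_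
      disjoint := ?_ }
  · intro v w
    constructor
    · intro h
      rcases eq_or_eq_neg_of_pt_eq hq v.2 w.2 (congrArg Subtype.val h) with h | h
      · exact ⟨1, Subtype.ext (by simp [h])⟩
      · exact ⟨-1, Subtype.ext (by simp [hsmul, h])⟩
    · rintro ⟨ε, rfl⟩
      refine Subtype.ext (pt_smul (ne_zero_of_quadratic hq (w.2.symm ▸ one_ne_zero)) ?_)
      exact_mod_cast ε.ne_zero
  · intro v
    have hv : v.1 ≠ 0 := ne_zero_of_quadratic hq (v.2.symm ▸ one_ne_zero)
    refine ⟨Metric.ball v ‖v.1‖, Metric.ball_mem_nhds _ (norm_pos_iff.2 hv), fun ε hε => ?_⟩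
    refine (Int.units_eq_one_or ε).resolve_right ?_
    rintro rfl
    obtain ⟨_, ⟨w, hw, rfl⟩, hw'⟩ := hε
    have h₁ : ‖v.1 - w.1‖ < ‖v.1‖ := by
      rwa [← dist_eq_norm, dist_comm]
    have h₂ : ‖v.1 + w.1‖ < ‖v.1‖ := by
      rw [Metric.mem_ball, dist_comm, Subtype.dist_eq, dist_eq_norm] at hw'
      simpa [hsmul] using hw'
    have h₃ : ‖(v.1 - w.1) + (v.1 + w.1)‖ = 2 * ‖v.1‖ := by
      rw [sub_add_add_cancel, ← two_smul ℝ v.1, norm_smul]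
      simp
    linarith [norm_add_le (v.1 - w.1) (v.1 + w.1)]

theorem exists_quadric_lift (hq : ∀ (c : ℂ) v, q (c • v) = c ^ 2 * q v) (hc : Continuous q)
    {A : Type*} [TopologicalSpace A] [SimplyConnectedSpace A] [LocallyPathConnectedSpace A]
    {G : A → P2} (hG : Continuous G) (hGq : ∀ a, G a ∈ pt '' {v | q v ≠ 0}) (a₀ : A)
    {v₀ : Fin 3 → ℂ} (hv₀ : q v₀ = 1) (h₀ : pt v₀ = G a₀) :
    ∃ F : A → Fin 3 → ℂ, Continuous F ∧ F a₀ = v₀ ∧ (∀ a, q (F a) = 1) ∧ ∀ a, pt (F a) = G a := by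
  obtain ⟨F, ⟨hF₀, hF⟩, -⟩ := (isCoveringMap_quadricProj hq hc).existsUnique_continuousMap_lifts
    ⟨fun a => ⟨G a, hGq a⟩, hG.subtype_mk _⟩ a₀ ⟨v₀, hv₀⟩ (Subtype.ext h₀)
  exact ⟨fun a => F a, continuous_subtype_val.comp F.continuous, congrArg Subtype.val hF₀,
    fun a => (F a).2, fun a => congrArg Subtype.val (congrFun hF a)⟩

theorem quadric_lift_unique (hq : ∀ (c : ℂ) v, q (c • v) = c ^ 2 * q v)
    {A : Type*} [TopologicalSpace A] {s : Set A} (hs : IsPreconnected s)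
    {F F' : A → Fin 3 → ℂ} (hF : ContinuousOn F s) (hF' : ContinuousOn F' s)
    (h : ∀ a ∈ s, q (F a) = 1) (h' : ∀ a ∈ s, q (F' a) = 1)
    (hpt : ∀ a ∈ s, pt (F a) = pt (F' a)) {a₀ : A} (ha₀ : a₀ ∈ s) (heq : F a₀ = F' a₀) :
    EqOn F F' s := by
  rw [isPreconnected_iff_preconnectedSpace] at hs
  rw [continuousOn_iff_continuous_domRestrict] at hF hF'
  have hclopen : IsClopen {a : s | F a = F' a} := by
    refine ⟨isClosed_eq hF hF', ?_⟩
    have : {a : s | F a = F' a} = {a : s | F a = -F' a}ᶜ := by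
      ext a
      have hne : F' a ≠ 0 := ne_zero_of_quadratic hq ((h' a a.2).symm ▸ one_ne_zero)
      rcases eq_or_eq_neg_of_pt_eq hq (h a a.2) (h' a a.2) (hpt a a.2) with h | h
      · simp only [mem_compl_iff, mem_ofPred_eq, h, true_iff]
        exact self_ne_neg.2 hne
      · simp only [mem_compl_iff, mem_ofPred_eq, h, not_true_eq_false, iff_false]
        exact neg_ne_self.2 hne
    rw [this]
    exact (isClosed_eq hF hF'.neg).isOpen_compl
  intro a ha
  have := hclopen.eq_univ ⟨⟨a₀, ha₀⟩, heq⟩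
  exact (this ▸ mem_univ _ : (⟨a, ha⟩ : s) ∈ {a : s | F a = F' a})

end DoubleCover

theorem eval_F₁ (v : Fin 3 → ℂ) : eval v F₁ =
    8 * v 2 ^ 2 - 20 * v 1 * v 2 + 36 * v 0 * v 2 + 17 * v 1 ^ 2 - 18 * v 0 * v 1 := by
  simp [F₁]

theorem eval_Q₁ (v : Fin 3 → ℂ) : eval v Q₁ =
    8 * v 0 ^ 2 * v 2 ^ 2 - 16 * v 0 * v 1 ^ 2 * v 2 + 52 * v 0 ^ 2 * v 1 * v 2
      - 36 * v 0 ^ 3 * v 2 - 37 * v 0 ^ 2 * v 1 ^ 2 + 18 * v 0 ^ 3 * v 1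
      - v 1 ^ 4 + 20 * v 0 * v 1 ^ 3 := by
  simp [Q₁]

theorem eval_F₂ (v : Fin 3 → ℂ) :
    eval v F₂ = 3 * v 0 ^ 2 + 2 * v 0 * v 1 + 108 * v 2 ^ 2 := by
  simp [F₂]

theorem eval_Q₂ (v : Fin 3 → ℂ) : eval v Q₂ =
    2 * v 0 * v 1 ^ 3 + 3 * v 0 ^ 2 * v 1 ^ 2 + 108 * v 1 ^ 2 * v 2 ^ 2 - v 0 ^ 4 := by
  simp [Q₂]

theorem eval_smul_F₁ (c : ℂ) (v : Fin 3 → ℂ) : eval (c • v) F₁ = c ^ 2 * eval v F₁ := by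
  simp only [eval_F₁, Pi.smul_apply, smul_eq_mul]
  ring

theorem eval_smul_F₂ (c : ℂ) (v : Fin 3 → ℂ) : eval (c • v) F₂ = c ^ 2 * eval v F₂ := by
  simp only [eval_F₂, Pi.smul_apply, smul_eq_mul]
  ring

theorem eval_smul_Q₁ (c : ℂ) (v : Fin 3 → ℂ) : eval (c • v) Q₁ = c ^ 4 * eval v Q₁ := by
  simp only [eval_Q₁, Pi.smul_apply, smul_eq_mul]
  ring

theorem eval_smul_Q₂ (c : ℂ) (v : Fin 3 → ℂ) : eval (c • v) Q₂ = c ^ 4 * eval v Q₂ := by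
  simp only [eval_Q₂, Pi.smul_apply, smul_eq_mul]
  ring

theorem ne_zero_of_eval_F₁ {v : Fin 3 → ℂ} (h : eval v F₁ ≠ 0) : v ≠ 0 :=
  ne_zero_of_quadratic (q := fun v => eval v F₁) eval_smul_F₁ h

theorem ne_zero_of_eval_F₂ {v : Fin 3 → ℂ} (h : eval v F₂ ≠ 0) : v ≠ 0 :=
  ne_zero_of_quadratic (q := fun v => eval v F₂) eval_smul_F₂ h

theorem pt_mem_VV_mul₁ {v : Fin 3 → ℂ} (hv : v ≠ 0) :
    pt v ∈ VV (F₁ * Q₁) ↔ eval v F₁ = 0 ∨ eval v Q₁ = 0 := by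
  rw [pt_mem_VV (d := 6) _ hv, map_mul, mul_eq_zero]
  intro c v
  rw [map_mul, map_mul, eval_smul_F₁, eval_smul_Q₁]
  ring

theorem pt_mem_VV_mul₂ {v : Fin 3 → ℂ} (hv : v ≠ 0) :
    pt v ∈ VV (F₂ * Q₂) ↔ eval v F₂ = 0 ∨ eval v Q₂ = 0 := by
  rw [pt_mem_VV (d := 6) _ hv, map_mul, mul_eq_zero]
  intro c v
  rw [map_mul, map_mul, eval_smul_F₂, eval_smul_Q₂]
  ring

theorem tendsto_pt_cocompact {v u : ℂ → Fin 3 → ℂ} (hu : Continuous u) (h0 : u 0 ≠ 0)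
    (h : ∀ s ≠ 0, ∃ c : ℂ, c ≠ 0 ∧ v s = c • u s⁻¹) (hv : ∀ s, v s ≠ 0) :
    Tendsto (fun s => pt (v s)) (cocompact ℂ) (𝓝 (pt (u 0))) := by
  rw [← Metric.cobounded_eq_cocompact]
  have h₁ : Tendsto (fun s : ℂ => pt (u s⁻¹)) (Bornology.cobounded ℂ) (𝓝 (pt (u 0))) :=
    (continuousAt_pt h0).tendsto.comp ((hu.tendsto 0).comp tendsto_inv₀_cobounded)
  refine h₁.congr' ?_
  filter_upwards [Bornology.eventually_ne_cobounded (0 : ℂ)] with s hs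
  obtain ⟨c, hc, hcs⟩ := h s hs
  have : u s⁻¹ ≠ 0 := fun h => hv s (by rw [hcs, h, smul_zero])
  rw [hcs, pt_smul this hc]

theorem finite_quadratic_roots {a : ℂ} (ha : a ≠ 0) (b c : ℂ) :
    {z : ℂ | a * z ^ 2 + b * z + c = 0}.Finite := by
  have hp : Polynomial.C a * Polynomial.X ^ 2 + Polynomial.C b * Polynomial.X +
      Polynomial.C c ≠ 0 := by
    intro h
    have := congrArg Polynomial.natDegree h
    rw [Polynomial.natDegree_quadratic ha] at this
    simp at this
  refine (Polynomial.rootSet_finite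
    (Polynomial.C a * Polynomial.X ^ 2 + Polynomial.C b * Polynomial.X + Polynomial.C c) ℂ).subset
      fun z hz => ?_
  rw [Polynomial.mem_rootSet]
  exact ⟨hp, by simpa using hz⟩

theorem continuous_vec3 {A : Type*} [TopologicalSpace A] {f g h : A → ℂ} (hf : Continuous f)
    (hg : Continuous g) (hh : Continuous h) : Continuous fun a => ![f a, g a, h a] := by
  refine continuous_pi fun i => ?_
  fin_cases i <;> assumption

theorem vec3_eq_iff {v : Fin 3 → ℂ} {a b c : ℂ} :
    v = ![a, b, c] ↔ v 0 = a ∧ v 1 = b ∧ v 2 = c := by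
  constructor
  · rintro rfl
    exact ⟨rfl, rfl, rfl⟩
  · rintro ⟨rfl, rfl, rfl⟩
    exact List.ofFn_inj.1 rfl

theorem disjoint_range_pt {q : (Fin 3 → ℂ) → ℂ} (hq : ∀ (c : ℂ) v, q (c • v) = c ^ 2 * q v)
    {k n : ℂ → Fin 3 → ℂ} (hk : ∀ t, q (k t) = 0) (hk0 : ∀ t, k t ≠ 0) (hn : ∀ s, q (n s) = 1) :
    Disjoint (range fun t => pt (k t)) (range fun s => pt (n s)) := by
  rw [Set.disjoint_left]
  rintro _ ⟨t, rfl⟩ ⟨s, hs⟩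
  have hn0 : n s ≠ 0 := ne_zero_of_quadratic hq (by simp [hn])
  obtain ⟨a, ha⟩ := (pt_eq_pt_iff (hk0 t) hn0).1 hs.symm
  have h := hk t
  rw [← ha, hq, hn, mul_one] at h
  apply hk0 t
  rw [← ha, pow_eq_zero_iff two_ne_zero |>.1 h, zero_smul]

section FirstSextic

/-- A parametrization of the conic `F₁ = 0` punctured at `center₁`. -/
def conic₁ (t : ℂ) : Fin 3 → ℂ := ![-(9 * t ^ 2 - 6 * t + 2) / 18, t, (1 + t) / 2]

/-- A parametrization of the quartic `Q₁ = 0` punctured at `center₁`, normalized by `F₁ = 1`. -/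
def quartic₁ (s : ℂ) : Fin 3 → ℂ :=
  ![(2 * s ^ 2 - 4 * s + 1) ^ 2 / 18, -(s * (2 * s ^ 2 - 4 * s + 1)) / 3,
    -((2 * s ^ 2 + 2 * s + 1) * (2 * s - 3)) / 12]

/-- A polynomial left inverse of `quartic₁`. -/
def quarticInv₁ (v : Fin 3 → ℂ) : ℂ :=
  (4 * (1 / 2 + v 1 - 2 * v 2) ^ 2 + 8 * (1 / 2 + v 1 - 2 * v 2) + 1 - 18 * v 0) / 4
    - 2 * (1 / 2 + v 1 - 2 * v 2) + 3 * v 1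

/-- Homogeneous coordinates of the point where both branches of the first sextic close up. -/
def center₁ : Fin 3 → ℂ := ![1, 0, 0]

theorem center₁_ne_zero : center₁ ≠ 0 := fun h => one_ne_zero (congrFun h 0 : (1 : ℂ) = 0)

theorem conic₁_ne_zero (t : ℂ) : conic₁ t ≠ 0 := by
  intro h
  have h1 : t = 0 := congrFun h 1
  have h2 : (1 + t) / 2 = 0 := congrFun h 2
  simp [h1] at h2

theorem eval_conic₁ (t : ℂ) : eval (conic₁ t) F₁ = 0 := by
  simp only [eval_F₁, conic₁, Matrix.cons_val]
  ring

theorem eval_quartic₁ (s : ℂ) : eval (quartic₁ s) F₁ = 1 := by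
  simp only [eval_F₁, quartic₁, Matrix.cons_val]
  ring

theorem eval_quartic₁_Q₁ (s : ℂ) : eval (quartic₁ s) Q₁ = 0 := by
  simp only [eval_Q₁, quartic₁, Matrix.cons_val]
  ring

theorem quartic₁_ne_zero (s : ℂ) : quartic₁ s ≠ 0 :=
  ne_zero_of_eval_F₁ (by simp [eval_quartic₁])

theorem quarticInv₁_quartic₁ (s : ℂ) : quarticInv₁ (quartic₁ s) = s := by
  simp only [quarticInv₁, quartic₁, Matrix.cons_val]
  ring

theorem continuous_conic₁ : Continuous conic₁ :=
  continuous_vec3 (by fun_prop) (by fun_prop) (by fun_prop)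

theorem continuous_quartic₁ : Continuous quartic₁ :=
  continuous_vec3 (by fun_prop) (by fun_prop) (by fun_prop)

theorem continuous_quarticInv₁ : Continuous quarticInv₁ := by
  unfold quarticInv₁
  fun_prop

theorem pt_conic₁_injective : Function.Injective fun t => pt (conic₁ t) := by
  intro t t' h
  obtain ⟨a, ha⟩ := (pt_eq_pt_iff (conic₁_ne_zero t) (conic₁_ne_zero t')).1 h
  have h1 : a * t' = t := congrFun ha 1
  have h2 : a * ((1 + t') / 2) = (1 + t) / 2 := congrFun ha 2
  have h3 : a = 1 := by linear_combination 2 * h2 - h1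
  rw [← h1, h3, one_mul]

theorem isPuncturedParam_conic₁ : IsPuncturedParam (fun t => pt (conic₁ t)) (pt center₁) where
  continuous := continuous_conic₁.pt_comp conic₁_ne_zero
  tendsto := by
    let u : ℂ → Fin 3 → ℂ := fun r =>
      ![-(9 - 6 * r + 2 * r ^ 2) / 18, r, (r ^ 2 + r) / 2]
    have hu : Continuous u := continuous_vec3 (by fun_prop) (by fun_prop) (by fun_prop)
    have hu0 : u 0 = (-1 / 2 : ℂ) • center₁ := by
      simp [u, center₁]
      norm_num
    have h0 : u 0 ≠ 0 := hu0 ▸ smul_ne_zero (by norm_num) center₁_ne_zero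
    have := tendsto_pt_cocompact (v := conic₁) hu h0 (fun s hs => ⟨s ^ 2, pow_ne_zero 2 hs, ?_⟩)
      conic₁_ne_zero
    · rwa [hu0, pt_smul center₁_ne_zero (by norm_num)] at this
    · symm
      refine vec3_eq_iff.2 ⟨?_, ?_, ?_⟩ <;> simp [u] <;> field_simp
  notMem_range := by
    rintro ⟨t, ht⟩
    obtain ⟨a, ha⟩ := (pt_eq_pt_iff (conic₁_ne_zero t) center₁_ne_zero).1 ht
    have h1 : a * 0 = t := congrFun ha 1
    have h2 : a * 0 = (1 + t) / 2 := congrFun ha 2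
    simp [← h1] at h2
  exists_finite := ⟨∅, finite_empty, fun _ _ _ h => pt_conic₁_injective h⟩

/-- The parameters of the double points of the first quartic. -/
def double₁ : Set ℂ := {s | 2 * s ^ 2 + -4 * s + 1 = 0} ∪ {s | 2 * s ^ 2 + 2 * s + 1 = 0}

theorem finite_double₁ : double₁.Finite :=
  (finite_quadratic_roots two_ne_zero _ _).union (finite_quadratic_roots two_ne_zero _ _)

theorem mem_double₁_of_eq_neg {s s' : ℂ} (h : quartic₁ s = -quartic₁ s') : s ∈ double₁ := by
  have h0 : (2 * s ^ 2 - 4 * s + 1) ^ 2 / 18 = -((2 * s' ^ 2 - 4 * s' + 1) ^ 2 / 18) :=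
    congrFun h 0
  have h1 : -(s * (2 * s ^ 2 - 4 * s + 1)) / 3 = -(-(s' * (2 * s' ^ 2 - 4 * s' + 1)) / 3) :=
    congrFun h 1
  have h2 : -((2 * s ^ 2 + 2 * s + 1) * (2 * s - 3)) / 12 =
      -(-((2 * s' ^ 2 + 2 * s' + 1) * (2 * s' - 3)) / 12) := congrFun h 2
  by_cases hE : 2 * s ^ 2 - 4 * s + 1 = 0
  · exact Or.inl (by simpa [sub_eq_add_neg] using hE)
  · have hT : s ^ 2 - s + s' ^ 2 - s' = 1 := by linear_combination h1 - 2 * h2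
    have hss : (2 * s ^ 2 - 4 * s + 1) ^ 2 * (s ^ 2 + s' ^ 2) = 0 := by
      linear_combination 18 * s' ^ 2 * h0 +
        -3 * (s * (2 * s ^ 2 - 4 * s + 1) - s' * (2 * s' ^ 2 - 4 * s' + 1)) * h1
    have hss' : s ^ 2 + s' ^ 2 = 0 := (mul_eq_zero.1 hss).resolve_left (pow_ne_zero 2 hE)
    have hs' : s' = -1 - s := by linear_combination hss' - hT
    right
    rw [mem_ofPred_eq]
    rw [hs'] at hss'
    linear_combination hss'

theorem isPuncturedParam_quartic₁ : IsPuncturedParam (fun s => pt (quartic₁ s)) (pt center₁) where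
  continuous := continuous_quartic₁.pt_comp quartic₁_ne_zero
  tendsto := by
    let u : ℂ → Fin 3 → ℂ := fun r =>
      ![(2 - 4 * r + r ^ 2) ^ 2 / 18, -(r * (2 - 4 * r + r ^ 2)) / 3,
        -((2 + 2 * r + r ^ 2) * (2 * r - 3 * r ^ 2)) / 12]
    have hu : Continuous u := continuous_vec3 (by fun_prop) (by fun_prop) (by fun_prop)
    have hu0 : u 0 = (2 / 9 : ℂ) • center₁ := by
      simp [u, center₁]
      norm_num
    have h0 : u 0 ≠ 0 := hu0 ▸ smul_ne_zero (by norm_num) center₁_ne_zero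
    have := tendsto_pt_cocompact (v := quartic₁) hu h0 (fun s hs => ⟨s ^ 4, pow_ne_zero 4 hs, ?_⟩)
      quartic₁_ne_zero
    · rwa [hu0, pt_smul center₁_ne_zero (by norm_num)] at this
    · symm
      refine vec3_eq_iff.2 ⟨?_, ?_, ?_⟩ <;> simp [u] <;> field_simp
  notMem_range := by
    rintro ⟨s, hs⟩
    obtain ⟨a, ha⟩ := (pt_eq_pt_iff (quartic₁_ne_zero s) center₁_ne_zero).1 hs
    have h := eval_quartic₁ s
    rw [← ha, eval_smul_F₁] at h
    simp [eval_F₁, center₁] at h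
  exists_finite := by
    refine ⟨double₁, finite_double₁, fun s hs s' h => ?_⟩
    rcases eq_or_eq_neg_of_pt_eq (q := fun v => eval v F₁) eval_smul_F₁ (eval_quartic₁ s)
      (eval_quartic₁ s') h with h | h
    · rw [← quarticInv₁_quartic₁ s, h, quarticInv₁_quartic₁]
    · exact absurd (mem_double₁_of_eq_neg h) hs

theorem pt_mem_conic₁ {v : Fin 3 → ℂ} (hv : v ≠ 0) :
    pt v ∈ insert (pt center₁) (range fun t => pt (conic₁ t)) ↔ eval v F₁ = 0 := by
  constructor
  · rintro (h | ⟨t, h⟩)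
    · obtain ⟨a, rfl⟩ := (pt_eq_pt_iff hv center₁_ne_zero).1 h
      simp [eval_F₁, center₁]
    · obtain ⟨a, rfl⟩ := (pt_eq_pt_iff hv (conic₁_ne_zero t)).1 h.symm
      rw [eval_smul_F₁, eval_conic₁, mul_zero]
  · intro h
    rw [eval_F₁] at h
    by_cases hl : 2 * v 2 - v 1 = 0
    · left
      have h1 : v 1 = 2 * v 2 := by linear_combination -hl
      rw [h1] at h
      have h2 : v 2 = 0 := by
        refine pow_eq_zero_iff two_ne_zero |>.1 ?_
        linear_combination h / 36
      refine (pt_eq_pt_iff hv center₁_ne_zero).2 ⟨v 0, ?_⟩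
      symm
      simp [center₁, vec3_eq_iff, h1, h2]
    · right
      refine ⟨v 1 / (2 * v 2 - v 1), ((pt_eq_pt_iff hv (conic₁_ne_zero _)).2
        ⟨2 * v 2 - v 1, ?_⟩).symm⟩
      symm
      simp only [conic₁, Matrix.smul_cons, smul_eq_mul, Matrix.smul_empty]
      refine vec3_eq_iff.2 ⟨?_, ?_, ?_⟩
      · field_simp
        linear_combination h
      · field_simp
      · rw [mul_div_assoc', mul_add, mul_div_cancel₀ _ hl]
        ring

theorem exists_pt_quartic₁_eq {v : Fin 3 → ℂ} (hv : eval v F₁ ≠ 0) (h : eval v Q₁ = 0) :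
    ∃ s, pt (quartic₁ s) = pt v := by
  have hv0 : v ≠ 0 := ne_zero_of_eval_F₁ hv
  suffices ∃ s, ∃ a : ℂ, a • quartic₁ s = v by
    obtain ⟨s, ha⟩ := this
    exact ⟨s, ((pt_eq_pt_iff hv0 (quartic₁_ne_zero s)).2 ha).symm⟩
  rw [eval_Q₁] at h
  by_cases h0 : v 0 = 0
  · have h1 : v 1 = 0 := by simpa [h0] using h
    obtain ⟨c, hc⟩ := IsAlgClosed.exists_pow_nat_eq (2 : ℂ) zero_lt_two
    have hE : 2 * (1 + c / 2) ^ 2 - 4 * (1 + c / 2) + 1 = 0 := by linear_combination hc / 2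
    have hw : quartic₁ (1 + c / 2) = ![0, 0, quartic₁ (1 + c / 2) 2] := by
      refine vec3_eq_iff.2 ⟨?_, ?_, rfl⟩ <;> simp [quartic₁, hE]
    have hw2 : quartic₁ (1 + c / 2) 2 ≠ 0 := by
      intro h2
      apply quartic₁_ne_zero (1 + c / 2)
      rw [hw, h2]
      simp
    refine ⟨1 + c / 2, v 2 / quartic₁ (1 + c / 2) 2, ?_⟩
    symm
    rw [hw]
    simp only [Matrix.smul_cons, smul_eq_mul, Matrix.smul_empty]
    refine vec3_eq_iff.2 ⟨?_, ?_, ?_⟩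
    · simp [h0]
    · simp [h1]
    · simp [hw2]
  · suffices ∃ s, ∃ a : ℂ, a • quartic₁ s = ![1, v 1 / v 0, v 2 / v 0] by
      obtain ⟨s, a, ha⟩ := this
      refine ⟨s, v 0 * a, ?_⟩
      rw [mul_smul, ha]
      symm
      simp only [Matrix.smul_cons, smul_eq_mul, Matrix.smul_empty]
      refine vec3_eq_iff.2 ⟨?_, ?_, ?_⟩ <;> field_simp
    have hxyz : v = v 0 • ![1, v 1 / v 0, v 2 / v 0] := by
      simp only [Matrix.smul_cons, smul_eq_mul, Matrix.smul_empty]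
      refine vec3_eq_iff.2 ⟨?_, ?_, ?_⟩ <;> field_simp
    rw [hxyz, ← eval_Q₁, eval_smul_Q₁, mul_eq_zero, or_iff_right (pow_ne_zero 4 h0), eval_Q₁] at h
    rw [hxyz, eval_smul_F₁, eval_F₁] at hv
    generalize v 1 / v 0 = y at *
    generalize v 2 / v 0 = z at *
    simp only [Matrix.cons_val] at h hv
    by_cases hy : y = 1
    · subst hy
      have hz : z = 0 := by
        refine pow_eq_zero_iff two_ne_zero |>.1 ?_
        linear_combination h / 8
      subst hz
      have hI := Complex.I_sq
      have hE : 2 * ((-1 + Complex.I) / 2) ^ 2 - 4 * ((-1 + Complex.I) / 2) + 1 =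
          3 - 3 * Complex.I := by linear_combination hI / 2
      have hN : 2 * ((-1 + Complex.I) / 2) ^ 2 + 2 * ((-1 + Complex.I) / 2) + 1 = 0 := by
        linear_combination hI / 2
      refine ⟨(-1 + Complex.I) / 2, Complex.I, ?_⟩
      simp only [quartic₁, Matrix.smul_cons, smul_eq_mul, Matrix.smul_empty, hE, hN]
      symm
      refine vec3_eq_iff.2 ⟨?_, ?_, ?_⟩
      · simp only [Matrix.cons_val]
        linear_combination (1 - Complex.I / 2) * hI
      · simp only [Matrix.cons_val]
        linear_combination (1 - Complex.I / 2) * hI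
      · simp
    · have hy' : y - 1 ≠ 0 := sub_ne_zero.2 hy
      obtain ⟨d, hd⟩ : ∃ d : ℂ, 3 * (y - 1) * (d + 3 - 2 * y) = 4 * z - (y - 1) * (4 * y - 9) :=
        ⟨(4 * z - (y - 1) * (4 * y - 9)) / (3 * (y - 1)) - 3 + 2 * y, by field_simp; ring⟩
      have hd' : d ^ 2 + 6 * d - 4 * y * d + 2 * y ^ 2 = 0 := by
        have : 9 * (y - 1) ^ 2 * (d ^ 2 + 6 * d - 4 * y * d + 2 * y ^ 2) = 0 := by
          linear_combination 2 * h + (3 * (y - 1) * (d + 3 - 2 * y) +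
            (4 * z - (y - 1) * (4 * y - 9))) * hd
        exact (mul_eq_zero.1 this).resolve_left (mul_ne_zero (by norm_num) (pow_ne_zero 2 hy'))
      have hz : z = ((y - 1) * (4 * y - 9) + 3 * (y - 1) * (d + 3 - 2 * y)) / 4 := by
        linear_combination -hd / 4
      have hd0 : d ≠ 0 := by
        rintro rfl
        have hy0 : y = 0 := by simpa using hd'
        apply hv
        rw [hz, hy0]
        norm_num
      have hE : 2 * (y / d) ^ 2 - 4 * (y / d) + 1 = -6 / d := by
        field_simp
        linear_combination hd'
      refine ⟨y / d, d ^ 2 / 2, ?_⟩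
      simp only [quartic₁, Matrix.smul_cons, smul_eq_mul, Matrix.smul_empty, hE]
      symm
      refine vec3_eq_iff.2 ⟨?_, ?_, ?_⟩
      · simp only [Matrix.cons_val]
        field_simp
        norm_num
      · simp only [Matrix.cons_val]
        field_simp
        ring
      · simp only [Matrix.cons_val]
        rw [hz]
        field_simp
        linear_combination (-(12 * d - 8 * y)) * hd'

theorem VV_mul₁ : VV (F₁ * Q₁) =
    insert (pt center₁) ((range fun t => pt (conic₁ t)) ∪ range fun s => pt (quartic₁ s)) := by
  ext P
  obtain ⟨v, hv, rfl⟩ := exists_pt_eq P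
  rw [pt_mem_VV_mul₁ hv, ← insert_union, mem_union, pt_mem_conic₁ hv]
  constructor
  · rintro (h | h)
    · exact Or.inl h
    · by_cases h' : eval v F₁ = 0
      · exact Or.inl h'
      · exact Or.inr (exists_pt_quartic₁_eq h' h)
  · rintro (h | ⟨s, h⟩)
    · exact Or.inl h
    · obtain ⟨a, rfl⟩ := (pt_eq_pt_iff hv (quartic₁_ne_zero s)).1 h.symm
      rw [eval_smul_Q₁, eval_quartic₁_Q₁, mul_zero]
      exact Or.inr rfl

/-- A nonvanishing lift of a map into the first quartic uses only one of the two signs. -/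
theorem exists_quartic₁_factor {g : ℂ → Fin 3 → ℂ} (hg : Continuous g)
    (hg1 : ∀ x, eval (g x) F₁ = 1) (hr : ∀ x, ∃ s, pt (quartic₁ s) = pt (g x))
    (hfin : ((fun x => pt (g x)) ⁻¹' ((fun s => pt (quartic₁ s)) '' double₁)).Finite) :
    ∃ φ : (Fin 3 → ℂ) → ℂ, Continuous φ ∧ ∀ x, pt (quartic₁ (φ (g x))) = pt (g x) := by
  have hclosed (f : ℂ → Fin 3 → ℂ) (hf : Continuous f) :
      IsClosed {x | quartic₁ (quarticInv₁ (f x)) = f x} :=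
    isClosed_eq (continuous_quartic₁.comp (continuous_quarticInv₁.comp hf)) hf
  have hp := hclosed g hg
  have hn := hclosed (fun x => -g x) hg.neg
  have hg0 (x) : g x ≠ 0 := ne_zero_of_eval_F₁ (by simp [hg1])
  have hcover (x) : quartic₁ (quarticInv₁ (g x)) = g x ∨
      quartic₁ (quarticInv₁ (-g x)) = -g x := by
    obtain ⟨s, hs⟩ := hr x
    rcases eq_or_eq_neg_of_pt_eq (q := fun v => eval v F₁) eval_smul_F₁ (eval_quartic₁ s)
      (hg1 x) hs with h | h
    · left
      rw [← h, quarticInv₁_quartic₁]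
    · right
      rw [← h, quarticInv₁_quartic₁]
  have hconn := isPreconnected_compl_finite hfin
  have hdisj : ((fun x => pt (g x)) ⁻¹' ((fun s => pt (quartic₁ s)) '' double₁))ᶜ ∩
      ({x | quartic₁ (quarticInv₁ (g x)) = g x} ∩
        {x | quartic₁ (quarticInv₁ (-g x)) = -g x}) = ∅ := by
    rw [eq_empty_iff_forall_notMem]
    rintro x ⟨hx, hxp, hxn⟩
    refine hx ⟨_, mem_double₁_of_eq_neg (s' := quarticInv₁ (-g x)) (hxp.trans ?_), congrArg pt hxp⟩
    rw [mem_ofPred_eq] at hxn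
    rw [hxn, neg_neg]
  rcases isPreconnected_iff_subset_of_disjoint_closed.1 hconn _ _ hp hn
    (fun x _ => hcover x) hdisj with h | h
  · have := hp.closure_subset_iff.2 h
    rw [(dense_compl_finite hfin).closure_eq] at this
    exact ⟨quarticInv₁, continuous_quarticInv₁, fun x => congrArg pt (this (mem_univ x))⟩
  · have := hn.closure_subset_iff.2 h
    rw [(dense_compl_finite hfin).closure_eq] at this
    refine ⟨fun v => quarticInv₁ (-v), continuous_quarticInv₁.comp continuous_neg, fun x => ?_⟩
    rw [← pt_neg (hg0 x)]
    exact congrArg pt (this (mem_univ x))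

end FirstSextic

section SecondSextic

/-- A parametrization of the conic `F₂ = 0` punctured at `center₂`. -/
def conic₂ (t : ℂ) : Fin 3 → ℂ := ![1, -(3 + 108 * t ^ 2) / 2, t]

/-- A parametrization of the quartic `Q₂ = 0` punctured at `center₂`, normalized by `F₂ = 1`. -/
def quartic₂ (s : ℂ) : Fin 3 → ℂ :=
  ![(1 - 3 * s ^ 2) / 2, ((1 - 3 * s ^ 2) / 2) ^ 2, (1 - s ^ 2) * s / 4]

/-- Homogeneous coordinates of the point where both branches of the second sextic close up. -/
def center₂ : Fin 3 → ℂ := ![0, 1, 0]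

theorem center₂_ne_zero : center₂ ≠ 0 := fun h => one_ne_zero (congrFun h 1 : (1 : ℂ) = 0)

theorem conic₂_ne_zero (t : ℂ) : conic₂ t ≠ 0 :=
  fun h => one_ne_zero (congrFun h 0 : (1 : ℂ) = 0)

theorem eval_conic₂ (t : ℂ) : eval (conic₂ t) F₂ = 0 := by
  simp only [eval_F₂, conic₂, Matrix.cons_val]
  ring

theorem eval_quartic₂ (s : ℂ) : eval (quartic₂ s) F₂ = 1 := by
  simp only [eval_F₂, quartic₂, Matrix.cons_val]
  ring

theorem eval_quartic₂_Q₂ (s : ℂ) : eval (quartic₂ s) Q₂ = 0 := by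
  simp only [eval_Q₂, quartic₂, Matrix.cons_val]
  ring

theorem quartic₂_ne_zero (s : ℂ) : quartic₂ s ≠ 0 :=
  ne_zero_of_eval_F₂ (by simp [eval_quartic₂])

theorem quartic₂_one : quartic₂ 1 = quartic₂ (-1) := by
  simp [quartic₂]

theorem continuous_conic₂ : Continuous conic₂ :=
  continuous_vec3 (by fun_prop) (by fun_prop) (by fun_prop)

theorem continuous_quartic₂ : Continuous quartic₂ :=
  continuous_vec3 (by fun_prop) (by fun_prop) (by fun_prop)

theorem isPuncturedParam_conic₂ : IsPuncturedParam (fun t => pt (conic₂ t)) (pt center₂) where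
  continuous := continuous_conic₂.pt_comp conic₂_ne_zero
  tendsto := by
    let u : ℂ → Fin 3 → ℂ := fun r => ![r ^ 2, -(3 * r ^ 2 + 108) / 2, r]
    have hu : Continuous u := continuous_vec3 (by fun_prop) (by fun_prop) (by fun_prop)
    have hu0 : u 0 = (-54 : ℂ) • center₂ := by
      simp [u, center₂]
      norm_num
    have h0 : u 0 ≠ 0 := hu0 ▸ smul_ne_zero (by norm_num) center₂_ne_zero
    have := tendsto_pt_cocompact (v := conic₂) hu h0 (fun s hs => ⟨s ^ 2, pow_ne_zero 2 hs, ?_⟩)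
      conic₂_ne_zero
    · rwa [hu0, pt_smul center₂_ne_zero (by norm_num)] at this
    · symm
      refine vec3_eq_iff.2 ⟨?_, ?_, ?_⟩ <;> simp [u] <;> field_simp
  notMem_range := by
    rintro ⟨t, ht⟩
    obtain ⟨a, ha⟩ := (pt_eq_pt_iff (conic₂_ne_zero t) center₂_ne_zero).1 ht
    have h1 : a * 0 = 1 := congrFun ha 0
    simp at h1
  exists_finite := by
    refine ⟨∅, finite_empty, fun t _ t' h => ?_⟩
    obtain ⟨a, ha⟩ := (pt_eq_pt_iff (conic₂_ne_zero t) (conic₂_ne_zero t')).1 h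
    have h0 : a * 1 = 1 := congrFun ha 0
    have h2 : a * t' = t := congrFun ha 2
    rw [← h2, ← mul_one a, h0, one_mul]

theorem isPuncturedParam_quartic₂ : IsPuncturedParam (fun s => pt (quartic₂ s)) (pt center₂) where
  continuous := continuous_quartic₂.pt_comp quartic₂_ne_zero
  tendsto := by
    let u : ℂ → Fin 3 → ℂ := fun r =>
      ![(r ^ 4 - 3 * r ^ 2) / 2, ((r ^ 2 - 3) / 2) ^ 2, (r ^ 3 - r) / 4]
    have hu : Continuous u := continuous_vec3 (by fun_prop) (by fun_prop) (by fun_prop)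
    have hu0 : u 0 = (9 / 4 : ℂ) • center₂ := by
      simp [u, center₂]
      norm_num
    have h0 : u 0 ≠ 0 := hu0 ▸ smul_ne_zero (by norm_num) center₂_ne_zero
    have := tendsto_pt_cocompact (v := quartic₂) hu h0 (fun s hs => ⟨s ^ 4, pow_ne_zero 4 hs, ?_⟩)
      quartic₂_ne_zero
    · rwa [hu0, pt_smul center₂_ne_zero (by norm_num)] at this
    · symm
      refine vec3_eq_iff.2 ⟨?_, ?_, ?_⟩ <;> simp [u] <;> field_simp
  notMem_range := by
    rintro ⟨s, hs⟩
    obtain ⟨a, ha⟩ := (pt_eq_pt_iff (quartic₂_ne_zero s) center₂_ne_zero).1 hs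
    have h := eval_quartic₂ s
    rw [← ha, eval_smul_F₂] at h
    simp [eval_F₂, center₂] at h
  exists_finite := by
    refine ⟨{s | 3 * s ^ 2 + 0 * s + -1 = 0} ∪ {s | 1 * s ^ 2 + 0 * s + -1 = 0},
      (finite_quadratic_roots three_ne_zero _ _).union (finite_quadratic_roots one_ne_zero _ _),
      fun s hs s' h => ?_⟩
    simp only [mem_union, mem_ofPred_eq, not_or] at hs
    obtain ⟨hs3, hs1⟩ := hs
    rcases eq_or_eq_neg_of_pt_eq (q := fun v => eval v F₂) eval_smul_F₂ (eval_quartic₂ s)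
      (eval_quartic₂ s') h with h | h
    · have h0 : (1 - 3 * s ^ 2) / 2 = (1 - 3 * s' ^ 2) / 2 := congrFun h 0
      have h2 : (1 - s ^ 2) * s / 4 = (1 - s' ^ 2) * s' / 4 := congrFun h 2
      have : (1 * s ^ 2 + 0 * s + -1) * (s - s') = 0 := by
        linear_combination (-4) * h2 + 2 / 3 * s' * h0
      exact sub_eq_zero.1 ((mul_eq_zero.1 this).resolve_left hs1)
    · have h0 : (1 - 3 * s ^ 2) / 2 = -((1 - 3 * s' ^ 2) / 2) := congrFun h 0
      have h1 : ((1 - 3 * s ^ 2) / 2) ^ 2 = -(((1 - 3 * s' ^ 2) / 2) ^ 2) := congrFun h 1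
      have : (3 * s ^ 2 + 0 * s + -1) ^ 2 = 0 := by
        linear_combination 2 * h1 + 2 * ((1 - 3 * s ^ 2) / 2 - (1 - 3 * s' ^ 2) / 2) * h0
      exact absurd (pow_eq_zero_iff two_ne_zero |>.1 this) hs3

theorem pt_mem_conic₂ {v : Fin 3 → ℂ} (hv : v ≠ 0) :
    pt v ∈ insert (pt center₂) (range fun t => pt (conic₂ t)) ↔ eval v F₂ = 0 := by
  constructor
  · rintro (h | ⟨t, h⟩)
    · obtain ⟨a, rfl⟩ := (pt_eq_pt_iff hv center₂_ne_zero).1 h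
      simp [eval_F₂, center₂]
    · obtain ⟨a, rfl⟩ := (pt_eq_pt_iff hv (conic₂_ne_zero t)).1 h.symm
      rw [eval_smul_F₂, eval_conic₂, mul_zero]
  · intro h
    rw [eval_F₂] at h
    by_cases h0 : v 0 = 0
    · left
      have h2 : v 2 = 0 := by simpa [h0] using h
      refine (pt_eq_pt_iff hv center₂_ne_zero).2 ⟨v 1, ?_⟩
      symm
      simp [center₂, vec3_eq_iff, h0, h2]
    · right
      refine ⟨v 2 / v 0, ((pt_eq_pt_iff hv (conic₂_ne_zero _)).2 ⟨v 0, ?_⟩).symm⟩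
      symm
      simp only [conic₂, Matrix.smul_cons, smul_eq_mul, Matrix.smul_empty]
      refine vec3_eq_iff.2 ⟨?_, ?_, ?_⟩
      · simp
      · field_simp
        linear_combination h
      · field_simp

theorem exists_quartic₂_eq {x z : ℂ} (h : 3 * x ^ 2 + 2 * x * x ^ 2 + 108 * z ^ 2 = 1) :
    ∃ s, quartic₂ s = ![x, x ^ 2, z] := by
  by_cases hx : x + 1 = 0
  · have hx' : x = -1 := eq_neg_of_add_eq_zero_left hx
    subst hx'
    have hz : z = 0 := by
      refine pow_eq_zero_iff two_ne_zero |>.1 ?_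
      linear_combination h / 108
    refine ⟨1, ?_⟩
    rw [hz, quartic₂]
    norm_num
  · have hs : (6 * z / (x + 1)) ^ 2 = (1 - 2 * x) / 3 := by
      field_simp
      linear_combination h
    refine ⟨6 * z / (x + 1), ?_⟩
    rw [quartic₂, hs]
    have h0 : (1 - 3 * ((1 - 2 * x) / 3)) / 2 = x := by ring
    refine vec3_eq_iff.2 ⟨h0, congrArg (· ^ 2) h0, ?_⟩
    simp only [Matrix.cons_val]
    field_simp
    ring

theorem exists_pt_quartic₂_eq {v : Fin 3 → ℂ} (hv : eval v F₂ ≠ 0) (h : eval v Q₂ = 0) :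
    ∃ s, pt (quartic₂ s) = pt v := by
  have hv0 : v ≠ 0 := ne_zero_of_eval_F₂ hv
  obtain ⟨r, hr⟩ := IsAlgClosed.exists_pow_nat_eq (eval v F₂) zero_lt_two
  have hr0 : r ≠ 0 := by
    rintro rfl
    exact hv (by simp [← hr])
  have hv1 : eval (r⁻¹ • v) F₂ = 1 := by
    rw [eval_smul_F₂, ← hr, inv_pow, inv_mul_cancel₀ (pow_ne_zero 2 hr0)]
  have hv2 : eval (r⁻¹ • v) Q₂ = 0 := by
    rw [eval_smul_Q₂, h, mul_zero]
  have hpt : pt (r⁻¹ • v) = pt v := pt_smul hv0 (inv_ne_zero hr0)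
  rw [← hpt]
  generalize r⁻¹ • v = w at *
  rw [eval_F₂] at hv1
  rw [eval_Q₂] at hv2
  have hsq : (w 1) ^ 2 = (w 0 ^ 2) ^ 2 := by linear_combination hv2 - w 1 ^ 2 * hv1
  rcases sq_eq_sq_iff_eq_or_eq_neg.1 hsq with h1 | h1
  · rw [h1] at hv1
    obtain ⟨s, hs⟩ := exists_quartic₂_eq hv1
    exact ⟨s, congrArg pt (hs.trans (vec3_eq_iff.2 ⟨rfl, h1, rfl⟩).symm)⟩
  · rw [h1] at hv1
    obtain ⟨s, hs⟩ := exists_quartic₂_eq (x := -w 0) (z := -w 2) (by linear_combination hv1)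
    refine ⟨s, ?_⟩
    have hws : quartic₂ s = -w := by
      rw [hs]
      symm
      refine vec3_eq_iff.2 ⟨rfl, ?_, rfl⟩
      rw [Pi.neg_apply, h1]
      ring
    rw [hws, pt_neg]
    exact neg_ne_zero.1 (hws ▸ quartic₂_ne_zero s)

theorem VV_mul₂ : VV (F₂ * Q₂) =
    insert (pt center₂) ((range fun t => pt (conic₂ t)) ∪ range fun s => pt (quartic₂ s)) := by
  ext P
  obtain ⟨v, hv, rfl⟩ := exists_pt_eq P
  rw [pt_mem_VV_mul₂ hv, ← insert_union, mem_union, pt_mem_conic₂ hv]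
  constructor
  · rintro (h | h)
    · exact Or.inl h
    · by_cases h' : eval v F₂ = 0
      · exact Or.inl h'
      · exact Or.inr (exists_pt_quartic₂_eq h' h)
  · rintro (h | ⟨s, h⟩)
    · exact Or.inl h
    · obtain ⟨a, rfl⟩ := (pt_eq_pt_iff hv (quartic₂_ne_zero s)).1 h.symm
      rw [eval_smul_Q₂, eval_quartic₂_Q₂, mul_zero]
      exact Or.inr rfl

end SecondSextic

/-- The two branches of the second quartic at its node are joined inside a simply connected chart
of the affine quadric `F₂ = 1`, so every lift to `F₁ = 1` takes the same value on them. -/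
theorem lift_quartic₂_node {e : P2 → P2} (he : Continuous e)
    (hF : ∀ v, eval v F₂ ≠ 0 → e (pt v) ∈ pt '' {w | eval w F₁ ≠ 0})
    {g : ℂ → Fin 3 → ℂ} (hg : Continuous g) (hg1 : ∀ s, eval (g s) F₁ = 1)
    (hge : ∀ s, pt (g s) = e (pt (quartic₂ s))) : g 1 = g (-1) := by
  obtain ⟨c, hc⟩ := IsAlgClosed.exists_pow_nat_eq (3 : ℂ) zero_lt_two
  have hc0 : c ≠ 0 := by
    rintro rfl
    norm_num at hc
  let ψ : ℂ × ℂ → Fin 3 → ℂ := fun a =>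
    ![a.2, (a.1 * (2 - a.2 * a.1) - 3 * a.2) / 2, (1 - a.2 * a.1) / (6 * c)]
  have hψ : Continuous ψ := continuous_vec3 (by fun_prop) (by fun_prop) (by fun_prop)
  have hψ1 (a) : eval (ψ a) F₂ = 1 := by
    simp only [ψ, eval_F₂, Matrix.cons_val]
    rw [div_pow, mul_pow, hc]
    ring
  have hψ0 (a) : ψ a ≠ 0 := ne_zero_of_eval_F₂ (by simp [hψ1])
  let τ : ℂ → ℂ × ℂ := fun s =>
    ((1 - c * s) * (c * s + 2) / (c * s + 1), (1 - (c * s) ^ 2) / 2)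
  have hU (s : ℂ) (hs : s ∈ ({-c⁻¹} : Set ℂ)ᶜ) : c * s + 1 ≠ 0 := by
    intro h
    apply hs
    rw [mem_singleton_iff]
    field_simp
    linear_combination h
  have hτ : ContinuousOn τ {-c⁻¹}ᶜ :=
    ((by fun_prop : Continuous fun s => (1 - c * s) * (c * s + 2)).continuousOn.div
      (by fun_prop : Continuous fun s => c * s + 1).continuousOn hU).prodMk
      (by fun_prop : Continuous fun s => (1 - (c * s) ^ 2) / 2).continuousOn
  have hψτ (s : ℂ) (hs : s ∈ ({-c⁻¹} : Set ℂ)ᶜ) : ψ (τ s) = quartic₂ s := by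
    have hs' := hU s hs
    have hup : (1 - (c * s) ^ 2) / 2 * ((1 - c * s) * (c * s + 2) / (c * s + 1)) =
        ((c * s) ^ 3 - 3 * (c * s) + 2) / 2 := by
      field_simp
      ring
    have hcs : (c * s) ^ 2 = 3 * s ^ 2 := by rw [mul_pow, hc]
    symm
    refine vec3_eq_iff.2 ⟨?_, ?_, ?_⟩
    · simp only [quartic₂, Matrix.cons_val, τ]
      rw [hcs]
    · simp only [quartic₂, Matrix.cons_val, τ]
      rw [hup, ← hcs]
      field_simp
      ring
    · simp only [quartic₂, Matrix.cons_val, τ]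
      rw [hup]
      field_simp
      linear_combination 4 * c * s ^ 3 * hc
  have h1 : (1 : ℂ) ∈ ({-c⁻¹} : Set ℂ)ᶜ := by
    intro h
    have hc1 : c = -1 := by
      rw [mem_singleton_iff, eq_comm, neg_eq_iff_eq_neg] at h
      rw [← inv_inv c, h, inv_neg, inv_one]
    norm_num [hc1] at hc
  have h2 : (-1 : ℂ) ∈ ({-c⁻¹} : Set ℂ)ᶜ := by
    intro h
    have hc1 : c = 1 := by
      rw [mem_singleton_iff, neg_inj, eq_comm] at h
      rw [← inv_inv c, h, inv_one]
    norm_num [hc1] at hc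
  have hτ1 : τ 1 = τ (-1) := by
    have h1' := hU _ h1
    have h2' := hU _ h2
    refine Prod.ext ?_ (by simp [τ])
    simp only [τ]
    rw [div_eq_div_iff h1' h2']
    linear_combination 2 * c * hc
  obtain ⟨Ψ, hΨ, hΨ0, hΨ1, hΨe⟩ := exists_quadric_lift (q := fun v => eval v F₁) eval_smul_F₁
    (MvPolynomial.continuous_eval F₁) (G := fun a => e (pt (ψ a))) (he.comp (hψ.pt_comp hψ0))
    (fun a => hF _ (by simp [hψ1])) (τ 1) (hg1 1) (by rw [hge, hψτ 1 h1])
  have hconn : IsPreconnected ({-c⁻¹} : Set ℂ)ᶜ := isPreconnected_compl_finite (finite_singleton _)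
  have heq := quadric_lift_unique (q := fun v => eval v F₁) eval_smul_F₁ hconn hg.continuousOn
    (hΨ.comp_continuousOn hτ) (fun s _ => hg1 s) (fun s _ => hΨ1 _)
    (fun s hs => by simp only [Function.comp_apply]; rw [hge, hΨe, hψτ s hs]) h1 hΨ0.symm
  rw [heq h1, heq h2, Function.comp_apply, Function.comp_apply, hτ1]

/-- There is no homeomorphism h : ℙ² → ℙ² with h(C⁽¹⁾) = C⁽²⁾; i.e. the pairs
(ℙ², C⁽¹⁾) and (ℙ², C⁽²⁾) are not homeomorphic, so the sextics C⁽¹⁾ = V(F₁·Q₁)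
and C⁽²⁾ = V(F₂·Q₂) form a Zariski pair. -/
theorem stmt_8 : ¬ ∃ h : P2 ≃ₜ P2, h '' VV (F₁ * Q₁) = VV (F₂ * Q₂) := by
  rintro ⟨h, hh⟩
  let e := h.symm
  have hk := isPuncturedParam_conic₂.homeomorph_comp e
  have hn := isPuncturedParam_quartic₂.homeomorph_comp e
  have hd : Disjoint (range fun t => pt (conic₁ t)) (range fun s => pt (quartic₁ s)) :=
    disjoint_range_pt (q := fun v => eval v F₁) eval_smul_F₁ eval_conic₁ conic₁_ne_zero
      eval_quartic₁
  have hunion : insert (pt center₁) ((range fun t => pt (conic₁ t)) ∪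
      range fun s => pt (quartic₁ s)) = insert (e (pt center₂))
        (range (e ∘ fun t => pt (conic₂ t)) ∪ range (e ∘ fun s => pt (quartic₂ s))) := by
    rw [range_comp, range_comp, ← image_union, ← image_insert_eq, ← VV_mul₁, ← VV_mul₂, ← hh,
      ← image_comp]
    simp [e]
  have hP : e (pt center₂) = pt center₁ :=
    IsPuncturedParam.eq_of_insert_union_eq hk hn isPuncturedParam_conic₁ isPuncturedParam_quartic₁
      hd hunion.symm
  rw [hP] at hk hn hunion
  have hnode : (1 : ℂ) ≠ -1 := by norm_num
  rcases IsPuncturedParam.range_eq_or isPuncturedParam_conic₁ isPuncturedParam_quartic₁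
    hd hk hn hunion with hr | ⟨hr, hr'⟩
  · obtain ⟨φ, hφ, hφe⟩ := isPuncturedParam_conic₁.exists_continuous_factor pt_conic₁_injective
      hn.continuous hr.le
    refine hnode (isPuncturedParam_conic₁.injective_of_comp_eq hn hr.symm hφ hφe ?_)
    apply pt_conic₁_injective
    simp only [hφe, Function.comp_apply, quartic₂_one]
  · have hmem (s : ℂ) : ∃ s', pt (quartic₁ s') = e (pt (quartic₂ s)) := by
      have : e (pt (quartic₂ s)) ∈ range (e ∘ fun s => pt (quartic₂ s)) := ⟨s, rfl⟩
      rwa [hr] at this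
    obtain ⟨s₀, hs₀⟩ := hmem 0
    obtain ⟨g, hg, -, hg1, hge⟩ := exists_quadric_lift (q := fun v => eval v F₁) eval_smul_F₁
      (MvPolynomial.continuous_eval F₁) hn.continuous
      (fun s => by
        obtain ⟨s', hs'⟩ := hmem s
        exact ⟨quartic₁ s', by simp [eval_quartic₁], hs'⟩) 0 (eval_quartic₁ s₀) hs₀
    have hF (v) (hv : eval v F₂ ≠ 0) : e (pt v) ∈ pt '' {w | eval w F₁ ≠ 0} := by
      obtain ⟨w, hw, hwv⟩ := exists_pt_eq (e (pt v))
      refine ⟨w, fun hw1 => hv ?_, hwv⟩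
      rw [← pt_mem_conic₂ (ne_zero_of_eval_F₂ hv), ← e.injective.mem_set_image, image_insert_eq,
        ← range_comp, hP, hr', ← hwv, pt_mem_conic₁ hw]
      exact hw1
    have hlift : g 1 = g (-1) := lift_quartic₂_node e.continuous hF hg hg1 hge
    obtain ⟨φ, hφ, hφe⟩ := exists_quartic₁_factor hg hg1
      (fun x => by
        rw [hge]
        exact hmem x)
      (by
        simp only [hge]
        exact hn.finite_preimage (finite_double₁.image _))
    refine hnode (isPuncturedParam_quartic₁.injective_of_comp_eq hn hr.symm (hφ.comp hg)
      (fun x => (hφe x).trans (hge x)) ?_)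
    rw [Function.comp_apply, Function.comp_apply, hlift]
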